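/- Let μ > 0, 0 < r ≤ μ, and ε > 0. The function ψ_{σ'}(Σ) = σ̂'(Σ₁₂/√(Σ₁₁Σ₂₂)) with σ̂'(ρ) = (π − arccos ρ)/π is (1/2)-Hölder continuous on M_{μ,r} in the following sense: for all A, B ∈ M_{μ,r} with ‖A−B‖_max ≤ (μ−r)ε², one has |ψ_{σ'}(A) − ψ_{σ'}(B)| ≤ ε. -/

import Mathlib

open Real

/-- Derivative of the dual ReLU activation: σ̂'(ρ) = (π - arccos ρ)/π. -/
noncomputable def hatSigma' (ρ : ℝ) : ℝ := (π - Real.arccos ρ) / π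

/-- The step-function dual kernel ψ_{σ'}(Σ) = σ̂'(Σ₁₂/√(Σ₁₁Σ₂₂)) as a function
of the entries (a,b,c) of the 2×2 covariance matrix ((a,b),(b,c)). -/
noncomputable def psiStep (a b c : ℝ) : ℝ := hatSigma' (b / Real.sqrt (a * c))

lemma arccos_aux (x y ε : ℝ) (hε : 0 < ε) (hx : x ∈ Set.Icc (-1 : ℝ) 1)
    (hy : y ∈ Set.Icc (-1 : ℝ) 1) (h : |x - y| ≤ 2 * ε ^ 2) :
    arccos x - arccos y ≤ π * ε := by
  have hx' := Real.cos_arccos hx.1 hx.2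
  have hy' := Real.cos_arccos hy.1 hy.2
  have h1 := Real.arccos_nonneg x
  have h2 := Real.arccos_nonneg y
  have h3 := Real.arccos_le_pi x
  have h4 := Real.arccos_le_pi y
  have hpi := Real.pi_pos
  set s := arccos x
  set t := arccos y
  rcases le_total s t with hst | hst
  · have : 0 < π * ε := by positivity
    linarith
  have hc : y - x = 2 * sin ((s + t) / 2) * sin ((s - t) / 2) := by
    rw [← hx', ← hy', Real.cos_sub_cos, add_comm t s,
      show (t - s) / 2 = -((s - t) / 2) by ring, Real.sin_neg]
    ring
  have hge : sin ((s - t) / 2) ≤ sin ((s + t) / 2) := by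
    have : sin ((s + t) / 2) - sin ((s - t) / 2) = 2 * sin (t / 2) * cos (s / 2) := by
      rw [Real.sin_sub_sin]; ring_nf
    have a1 : 0 ≤ sin (t / 2) := Real.sin_nonneg_of_nonneg_of_le_pi (by linarith) (by linarith)
    have a2 : 0 ≤ cos (s / 2) := Real.cos_nonneg_of_neg_pi_div_two_le_of_le (by linarith) (by linarith)
    have := mul_nonneg a1 a2
    linarith
  have hj : 2 / π * ((s - t) / 2) ≤ sin ((s - t) / 2) :=
    Real.mul_le_sin (by linarith) (by linarith)
  have hj0 : 0 ≤ 2 / π * ((s - t) / 2) := by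
    have : 0 ≤ s - t := by linarith
    positivity
  have hb : y - x ≤ 2 * ε ^ 2 := by
    have := (abs_le.mp h).1
    linarith
  have hs2 : sin ((s - t) / 2) ≤ ε := by
    apply le_of_sq_le_sq _ hε.le
    nlinarith
  have : 2 / π * ((s - t) / 2) ≤ ε := hj.trans hs2
  have e : s - t = π * (2 / π * ((s - t) / 2)) := by field_simp
  rw [e]
  exact mul_le_mul_of_nonneg_left this hpi.le

lemma rho_mem (a b c : ℝ) (h : b ^ 2 < a * c) :
    b / √(a * c) ∈ Set.Icc (-1 : ℝ) 1 := by
  have hp : 0 < a * c := by nlinarith [sq_nonneg b]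
  have hs : 0 < √(a * c) := Real.sqrt_pos.mpr hp
  have : |b| ≤ √(a * c) := Real.abs_le_sqrt h.le
  rw [Set.mem_Icc, ← abs_le, abs_div, abs_of_pos hs]
  exact (div_le_one hs).mpr this

lemma rho_aux (m ε a b c a' b' c' : ℝ) (hm : 0 ≤ m)
    (ha : m ≤ a) (hc : m ≤ c) (ha' : m ≤ a') (hc' : m ≤ c')
    (hpd : b ^ 2 < a * c) (hpd' : b' ^ 2 < a' * c')
    (h1 : |a - a'| ≤ m * ε ^ 2) (h2 : |b - b'| ≤ m * ε ^ 2) (h3 : |c - c'| ≤ m * ε ^ 2)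
    (hle : a * c ≤ a' * c') :
    |b / √(a * c) - b' / √(a' * c')| ≤ 2 * ε ^ 2 := by
  have hp : 0 < a * c := by nlinarith [sq_nonneg b]
  have hp' : 0 < a' * c' := by linarith
  have hs : 0 < √(a * c) := Real.sqrt_pos.mpr hp
  have hs' : 0 < √(a' * c') := Real.sqrt_pos.mpr hp'
  have hss : √(a * c) ≤ √(a' * c') := Real.sqrt_le_sqrt hle
  have hms : m ≤ √(a * c) := Real.le_sqrt_of_sq_le (by nlinarith)
  have hup : √(a' * c') ≤ √(a * c) * (1 + ε ^ 2) := by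
    rw [Real.sqrt_le_left (by positivity), mul_pow, Real.sq_sqrt hp.le]
    have e2 := sq_nonneg ε
    have k1 : a' ≤ a * (1 + ε ^ 2) := by
      have := (abs_le.mp h1).1
      nlinarith
    have k2 : c' ≤ c * (1 + ε ^ 2) := by
      have := (abs_le.mp h3).1
      nlinarith
    have := mul_le_mul k1 k2 (by linarith) (by have : 0 ≤ a := by linarith
                                               positivity)
    linarith
  have hr := abs_le.mpr (Set.mem_Icc.mp (rho_mem a' b' c' hpd'))
  have key : b / √(a * c) - b' / √(a' * c')
      = (b - b') / √(a * c) + b' / √(a' * c') * ((√(a' * c') - √(a * c)) / √(a * c)) := by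
    field_simp
    ring
  rw [key]
  have t1 : |(b - b') / √(a * c)| ≤ ε ^ 2 := by
    rw [abs_div, abs_of_pos hs, div_le_iff₀ hs]
    nlinarith [sq_nonneg ε]
  have t2 : |(√(a' * c') - √(a * c)) / √(a * c)| ≤ ε ^ 2 := by
    rw [abs_div, abs_of_pos hs, div_le_iff₀ hs, abs_of_nonneg (by linarith)]
    linarith
  refine (abs_add_le _ _).trans ?_
  rw [abs_mul (b' / √(a' * c'))]
  have := mul_le_mul hr t2 (abs_nonneg _) zero_le_one
  linarith

/-- (1/2)-Hölder continuity of ψ_{σ'} on M_{μ,r}: if ‖A - B‖_max ≤ (μ-r)ε² then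
|ψ_{σ'}(A) - ψ_{σ'}(B)| ≤ ε. -/
theorem psi_step_holder (μ r ε : ℝ) (hμ : 0 < μ) (hr : 0 < r) (hrμ : r ≤ μ)
    (hε : 0 < ε) (a b c a' b' c' : ℝ)
    (ha : a ∈ Set.Icc (μ - r) (μ + r)) (hc : c ∈ Set.Icc (μ - r) (μ + r))
    (ha' : a' ∈ Set.Icc (μ - r) (μ + r)) (hc' : c' ∈ Set.Icc (μ - r) (μ + r))
    (hpd : b ^ 2 < a * c) (hpd' : b' ^ 2 < a' * c')
    (hclose : max (max |a - a'| |b - b'|) |c - c'| ≤ (μ - r) * ε ^ 2) :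
    |psiStep a b c - psiStep a' b' c'| ≤ ε := by
  obtain ⟨h12, h3⟩ := max_le_iff.mp hclose
  obtain ⟨h1, h2⟩ := max_le_iff.mp h12
  have hm : 0 ≤ μ - r := by linarith
  have hrho : |b / √(a * c) - b' / √(a' * c')| ≤ 2 * ε ^ 2 := by
    rcases le_total (a * c) (a' * c') with h | h
    · exact rho_aux (μ - r) ε a b c a' b' c' hm ha.1 hc.1 ha'.1 hc'.1 hpd hpd' h1 h2 h3 h
    · rw [abs_sub_comm] at h1 h2 h3 ⊢
      exact rho_aux (μ - r) ε a' b' c' a b c hm ha'.1 hc'.1 ha.1 hc.1 hpd' hpd h1 h2 h3 h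
  have m1 := rho_mem a b c hpd
  have m2 := rho_mem a' b' c' hpd'
  have g1 := arccos_aux _ _ ε hε m1 m2 hrho
  have g2 := arccos_aux _ _ ε hε m2 m1 (by rwa [abs_sub_comm])
  have hpi := Real.pi_pos
  unfold psiStep hatSigma'
  rw [← sub_div, abs_div, abs_of_pos hpi, div_le_iff₀ hpi, abs_le]
  constructor <;> linarith
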